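/- For every k ≥ 6, the complete k-partite graph K_{4,3,…,3,1,1} (one part of size 4, k − 3 parts of size 3, and two singleton parts) has game chromatic number χ_g(K_{4,3,…,3,1,1}) ≤ 2k − 4. -/

import Mathlib

/-- A color `c` is legal for vertex `v` in partial coloring `f` if no neighbor of `v`
is already colored with `c`. -/
def legalColor {V C : Type} (G : SimpleGraph V) (f : V → Option C) (v : V) (c : C) : Prop :=
  ∀ w, G.Adj v w → f w ≠ some c

/-- A move in the coloring game: choose an uncolored vertex and color it with a legal color. -/
def gameMove {V C : Type} [DecidableEq V] (G : SimpleGraph V) (f f' : V → Option C) : Prop :=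
  ∃ v c, f v = none ∧ legalColor G f v c ∧ f' = Function.update f v (some c)

/-- Every vertex is colored. -/
def isFull {V C : Type} (f : V → Option C) : Prop := ∀ v, (f v).isSome

/-- Some uncolored vertex has no legal color (then Bob wins). -/
def isStuck {V C : Type} (G : SimpleGraph V) (f : V → Option C) : Prop :=
  ∃ v, f v = none ∧ ∀ c, ¬ legalColor G f v c

/-- It is Alice's turn when an even number of vertices are colored
(Alice moves first, and each move colors exactly one vertex). -/
def aliceTurn {V C : Type} [Fintype V] (f : V → Option C) : Prop :=
  Even (Finset.univ.filter (fun v => (f v).isSome = true)).card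

/-- Alice has a winning strategy from position `f` when `n` vertices remain uncolored:
Alice wins exactly the plays in which the entire graph gets colored; as soon as some
uncolored vertex has no legal color, Bob wins. -/
def aliceWinsFrom {V C : Type} [Fintype V] [DecidableEq V] (G : SimpleGraph V) :
    ℕ → (V → Option C) → Prop
  | 0, f => isFull f
  | n + 1, f => isFull f ∨ (¬ isStuck G f ∧
      ((aliceTurn f ∧ ∃ f', gameMove G f f' ∧ aliceWinsFrom G n f') ∨
       (¬ aliceTurn f ∧ ∀ f', gameMove G f f' → aliceWinsFrom G n f')))

/-- Alice has a winning strategy in the graph coloring game on `G` with `m` colors. -/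
def aliceWins {V : Type} [Fintype V] [DecidableEq V] (G : SimpleGraph V) (m : ℕ) : Prop :=
  aliceWinsFrom (C := Fin m) G (Fintype.card V) (fun _ => none)

/-- The game chromatic number: the least number of colors for which Alice has
a winning strategy. -/
noncomputable def gameChromaticNumber {V : Type} [Fintype V] [DecidableEq V]
    (G : SimpleGraph V) : ℕ :=
  sInf {m | aliceWins G m}

/-- The complete multipartite graph `K_{r 0, …, r (k-1)}`. -/
def K (k : ℕ) (r : Fin k → ℕ) : SimpleGraph (Σ i : Fin k, Fin (r i)) :=
  SimpleGraph.completeMultipartiteGraph (fun i => Fin (r i))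

/-- With Bob to move, `a`, `b`, `c` parts of size 4, 3, 1 without a colored vertex, `t` uncolored
vertices in the other parts and `F` unused colors, Alice has a winning continuation. -/
def BobSafe (a b c t F : ℕ) : Prop :=
  a + b + c = 0 ∨ 2 * (a + b + c) ≤ F ∨
  (a ≤ 1 ∧ c = 0 ∧ 4 * (a + b) + t ≤ 2 * F + 4 ∧ (a + b = 1 → 2 + t ≤ 2 * F) ∧
    (a + b = 2 → t ≠ 1)) ∨
  (a ≤ 1 ∧ c = 1 ∧ 4 * (a + b + 1) + t ≤ 2 * F + 6 ∧ (a + b = 0 → 2 + t ≤ 2 * F) ∧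
    (a + b = 1 → 4 + t ≤ 2 * F) ∧ (a + b = 2 → 7 + t ≤ 2 * F) ∧
    (a = 1 → b = 2 → 11 + t ≤ 2 * F))

/-- With Alice to move, every part has a colored vertex or some move leads to a position
satisfying `BobSafe`: reusing a color in a part that has one, or starting a part of size
4, 3 or 1 with an unused color. -/
def AliceSafe (a b c t F : ℕ) : Prop :=
  a + b + c = 0 ∨ (0 < t ∧ BobSafe a b c (t - 1) F) ∨
  (0 < F ∧ ((0 < a ∧ BobSafe (a - 1) b c (t + 3) (F - 1)) ∨
    (0 < b ∧ BobSafe a (b - 1) c (t + 2) (F - 1)) ∨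
    (0 < c ∧ BobSafe a b (c - 1) t (F - 1))))

theorem BobSafe.pos {a b c t F : ℕ} (h : BobSafe a b c t F) (hn : 0 < a + b + c) : 0 < F := by
  unfold BobSafe at h; omega

theorem AliceSafe.pos {a b c t F : ℕ} (h : AliceSafe a b c t F) (hn : 0 < a + b + c) : 0 < F := by
  rcases h with h | h | h
  · omega
  · exact h.2.pos hn
  · exact h.1

theorem AliceSafe.of_le {a b c t F : ℕ} (h : 2 * (a + b + c) ≤ F + 1) : AliceSafe a b c t F := by
  rcases Nat.eq_zero_or_pos (a + b + c) with h0 | h0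
  · exact Or.inl h0
  · refine Or.inr (Or.inr ⟨by omega, ?_⟩)
    rcases Nat.eq_zero_or_pos a with ha | ha
    · rcases Nat.eq_zero_or_pos b with hb | hb
      · exact Or.inr (Or.inr ⟨by omega, Or.inr (Or.inl (by omega))⟩)
      · exact Or.inr (Or.inl ⟨hb, Or.inr (Or.inl (by omega))⟩)
    · exact Or.inl ⟨ha, Or.inr (Or.inl (by omega))⟩

theorem BobSafe.four {a b c t F : ℕ} (h : BobSafe a b c t F) (ha : 0 < a) :
    AliceSafe (a - 1) b c (t + 3) (F - 1) := by
  by_cases hd : 2 * (a - 1 + b + c) ≤ F - 1 + 1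
  · exact .of_le hd
  · refine Or.inr (Or.inl ⟨by omega, ?_⟩)
    rcases h with h | h | h | h
    · omega
    · omega
    · exact Or.inr (Or.inr (Or.inl (by omega)))
    · exact Or.inr (Or.inr (Or.inr (by omega)))

theorem BobSafe.three {a b c t F : ℕ} (h : BobSafe a b c t F) (hb : 0 < b) :
    AliceSafe a (b - 1) c (t + 2) (F - 1) := by
  by_cases hd : 2 * (a + (b - 1) + c) ≤ F - 1 + 1
  · exact .of_le hd
  · refine Or.inr (Or.inl ⟨by omega, ?_⟩)
    rcases h with h | h | h | h
    · omega
    · omega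
    · exact Or.inr (Or.inr (Or.inl (by omega)))
    · exact Or.inr (Or.inr (Or.inr (by omega)))

theorem BobSafe.one {a b c t F : ℕ} (h : BobSafe a b c t F) (hc : 0 < c) :
    AliceSafe a b (c - 1) t (F - 1) := by
  by_cases hd : 2 * (a + b + (c - 1)) ≤ F - 1 + 1
  · exact .of_le hd
  rcases h with h | h | h | h
  · omega
  · omega
  · omega
  · rcases Nat.eq_zero_or_pos t with ht | ht
    · refine Or.inr (Or.inr ⟨by omega, Or.inr (Or.inl ⟨by omega, Or.inr (Or.inr (Or.inl ?_))⟩)⟩)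
      omega
    · exact Or.inr (Or.inl ⟨ht, Or.inr (Or.inr (Or.inl (by omega)))⟩)

theorem BobSafe.reuse {a b c t F : ℕ} (h : BobSafe a b c t F) (ht : 0 < t) :
    AliceSafe a b c (t - 1) F := by
  by_cases hd : 2 * (a + b + c) ≤ F + 1
  · exact .of_le hd
  rcases Nat.eq_zero_or_pos (t - 1) with ht' | ht'
  · rcases h with h | h | h | h
    · omega
    · omega
    · refine Or.inr (Or.inr ⟨by omega, Or.inr (Or.inl ⟨by omega, Or.inr (Or.inr (Or.inl ?_))⟩)⟩)
      omega
    · refine Or.inr (Or.inr ⟨by omega, Or.inr (Or.inr ⟨by omega, Or.inr (Or.inr (Or.inl ?_))⟩)⟩)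
      omega
  · refine Or.inr (Or.inl ⟨ht', ?_⟩)
    rcases h with h | h | h | h
    · omega
    · omega
    · exact Or.inr (Or.inr (Or.inl (by omega)))
    · exact Or.inr (Or.inr (Or.inr (by omega)))

theorem BobSafe.waste {a b c t F : ℕ} (h : BobSafe a b c t F) (ht : 0 < t) :
    AliceSafe a b c (t - 1) (F - 1) := by
  by_cases hd : 2 * (a + b + c) ≤ F - 1 + 1
  · exact .of_le hd
  rcases Nat.eq_zero_or_pos (t - 1) with ht' | ht'
  · rcases h with h | h | h | h
    · omega
    · omega
    · refine Or.inr (Or.inr ⟨by omega, Or.inr (Or.inl ⟨by omega, Or.inr (Or.inr (Or.inl ?_))⟩)⟩)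
      omega
    · refine Or.inr (Or.inr ⟨by omega, Or.inr (Or.inr ⟨by omega, Or.inr (Or.inr (Or.inl ?_))⟩)⟩)
      omega
  · refine Or.inr (Or.inl ⟨ht', ?_⟩)
    rcases h with h | h | h | h
    · omega
    · omega
    · exact Or.inr (Or.inr (Or.inl (by omega)))
    · exact Or.inr (Or.inr (Or.inr (by omega)))

theorem aliceSafe_initial {b : ℕ} (hb : 3 ≤ b) : AliceSafe 1 b 2 0 (2 * b + 2) := by
  refine Or.inr (Or.inr ⟨by omega, Or.inr (Or.inr ⟨by omega, Or.inr (Or.inr (Or.inr ?_))⟩)⟩)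
  omega

section Position

variable {k m : ℕ} {r : Fin k → ℕ}

/-- The parts with no colored vertex. -/
def untouchedParts (f : (Σ i : Fin k, Fin (r i)) → Option (Fin m)) : Finset (Fin k) :=
  Finset.univ.filter fun i => ∀ j, f ⟨i, j⟩ = none

/-- The number of parts of size `s` with no colored vertex. -/
def untouchedCount (f : (Σ i : Fin k, Fin (r i)) → Option (Fin m)) (s : ℕ) : ℕ :=
  ((untouchedParts f).filter fun i => r i = s).card

/-- The uncolored vertices lying in a part that already has a colored vertex. -/
def openVertices (f : (Σ i : Fin k, Fin (r i)) → Option (Fin m)) :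
    Finset (Σ i : Fin k, Fin (r i)) :=
  Finset.univ.filter fun v => f v = none ∧ v.1 ∉ untouchedParts f

/-- The colors not used so far. -/
def freshColors (f : (Σ i : Fin k, Fin (r i)) → Option (Fin m)) : Finset (Fin m) :=
  Finset.univ.filter fun c => ∀ v, f v ≠ some c

/-- Each color is used in at most one part. -/
def IsProperPosition (f : (Σ i : Fin k, Fin (r i)) → Option (Fin m)) : Prop :=
  ∀ v w c, f v = some c → f w = some c → v.1 = w.1

variable {f : (Σ i : Fin k, Fin (r i)) → Option (Fin m)} {v : Σ i : Fin k, Fin (r i)} {c : Fin m}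

theorem mem_untouchedParts {i : Fin k} : i ∈ untouchedParts f ↔ ∀ j, f ⟨i, j⟩ = none := by
  simp [untouchedParts]

theorem legalColor_K : legalColor (K k r) f v c ↔ ∀ w, f w = some c → v.1 = w.1 := by
  unfold legalColor K
  refine forall_congr' fun w => ?_
  simp only [SimpleGraph.comap_adj, SimpleGraph.top_adj]
  tauto

theorem legalColor_of_mem_freshColors (hc : c ∈ freshColors f) : legalColor (K k r) f v c := by
  rw [legalColor_K]
  intro w hw
  simp only [freshColors, Finset.mem_filter] at hc
  exact absurd hw (hc.2 w)

theorem mem_freshColors_of_legalColor (hv : v.1 ∈ untouchedParts f)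
    (hc : legalColor (K k r) f v c) : c ∈ freshColors f := by
  rw [legalColor_K] at hc
  simp only [freshColors, Finset.mem_filter, Finset.mem_univ, true_and]
  intro w hw
  rw [mem_untouchedParts, hc w hw] at hv
  simp [hv w.2] at hw

theorem IsProperPosition.exists_legalColor (hf : IsProperPosition f)
    (hv : v.1 ∉ untouchedParts f) : ∃ c ∉ freshColors f, legalColor (K k r) f v c := by
  simp only [mem_untouchedParts, not_forall] at hv
  obtain ⟨j, hj⟩ := hv
  obtain ⟨c, hc⟩ := Option.ne_none_iff_exists'.1 hj
  refine ⟨c, ?_, legalColor_K.2 fun w hw => hf ⟨v.1, j⟩ w c hc hw⟩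
  simp only [freshColors, Finset.mem_filter, not_and, not_forall]
  exact fun _ => ⟨_, fun h => h hc⟩

theorem IsProperPosition.update (hf : IsProperPosition f) (hc : legalColor (K k r) f v c) :
    IsProperPosition (Function.update f v (some c)) := by
  rw [legalColor_K] at hc
  intro u w d hu hw
  by_cases h1 : u = v <;> by_cases h2 : w = v
  · rw [h1, h2]
  · subst h1
    simp only [Function.update_self, Option.some.injEq] at hu
    rw [Function.update_of_ne h2] at hw
    exact hc w (hu ▸ hw)
  · subst h2
    simp only [Function.update_self, Option.some.injEq] at hw
    rw [Function.update_of_ne h1] at hu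
    exact (hc u (hw ▸ hu)).symm
  · rw [Function.update_of_ne h1] at hu
    rw [Function.update_of_ne h2] at hw
    exact hf u w d hu hw

theorem freshColors_update (hv : f v = none) :
    freshColors (Function.update f v (some c)) = (freshColors f).erase c := by
  ext d
  simp only [freshColors, Finset.mem_filter, Finset.mem_univ, true_and, Finset.mem_erase]
  constructor
  · intro h
    refine ⟨fun hd => h v (by simp [hd]), fun w => ?_⟩
    by_cases hw : w = v
    · simp [hw, hv]
    · simpa [Function.update_of_ne hw] using h w
  · rintro ⟨hd, h⟩ w
    by_cases hw : w = v
    · subst hw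
      simpa using fun h => hd h.symm
    · simpa [Function.update_of_ne hw] using h w

theorem untouchedParts_update :
    untouchedParts (Function.update f v (some c)) = (untouchedParts f).erase v.1 := by
  ext i
  simp only [mem_untouchedParts, Finset.mem_erase]
  constructor
  · intro h
    have hi : i ≠ v.1 := by
      rintro rfl
      simpa using h v.2
    refine ⟨hi, fun j => ?_⟩
    have hne : (⟨i, j⟩ : Σ i : Fin k, Fin (r i)) ≠ v := fun e => hi (congrArg Sigma.fst e)
    simpa [Function.update_of_ne hne] using h j
  · rintro ⟨hi, h⟩ j
    have hne : (⟨i, j⟩ : Σ i : Fin k, Fin (r i)) ≠ v := fun e => hi (congrArg Sigma.fst e)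
    simpa [Function.update_of_ne hne] using h j

theorem untouchedCount_update_of_notMem (hv : v.1 ∉ untouchedParts f) (s : ℕ) :
    untouchedCount (Function.update f v (some c)) s = untouchedCount f s := by
  rw [untouchedCount, untouchedParts_update, Finset.erase_eq_of_notMem hv, untouchedCount]

theorem untouchedCount_update_of_ne {s : ℕ} (hs : r v.1 ≠ s) :
    untouchedCount (Function.update f v (some c)) s = untouchedCount f s := by
  rw [untouchedCount, untouchedParts_update, Finset.filter_erase,
    Finset.erase_eq_of_notMem (by simp [hs]), untouchedCount]

theorem untouchedCount_update_of_mem (hv : v.1 ∈ untouchedParts f) :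
    untouchedCount (Function.update f v (some c)) (r v.1) = untouchedCount f (r v.1) - 1 := by
  rw [untouchedCount, untouchedParts_update, Finset.filter_erase,
    Finset.card_erase_of_mem (by simp [hv]), untouchedCount]

theorem untouchedCount_pos (hv : v.1 ∈ untouchedParts f) : 0 < untouchedCount f (r v.1) :=
  Finset.card_pos.2 ⟨v.1, by simp [hv]⟩

theorem card_openVertices_update_of_notMem (hv : f v = none) (h : v.1 ∉ untouchedParts f) :
    (openVertices (Function.update f v (some c))).card = (openVertices f).card - 1 := by
  rw [← Finset.card_erase_of_mem (a := v) (by simp [openVertices, hv, h])]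
  congr 1
  ext w
  simp only [openVertices, untouchedParts_update, Finset.erase_eq_of_notMem h,
    Finset.mem_filter, Finset.mem_univ, true_and, Finset.mem_erase]
  by_cases hw : w = v
  · simp [hw]
  · simp [hw]

theorem card_openVertices_update_of_mem (h : v.1 ∈ untouchedParts f) :
    (openVertices (Function.update f v (some c))).card =
      (openVertices f).card + (r v.1 - 1) := by
  have hfib : (Finset.univ.map (Function.Embedding.sigmaMk (β := fun i => Fin (r i)) v.1)).card
      = r v.1 := by simp
  have hmem : ∀ w, w ∈ Finset.univ.map (Function.Embedding.sigmaMk (β := fun i => Fin (r i)) v.1)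
      ↔ w.1 = v.1 := by
    rintro ⟨i, j⟩
    simp only [Finset.mem_map, Finset.mem_univ, true_and, Function.Embedding.sigmaMk_apply]
    constructor
    · rintro ⟨j', hj'⟩
      exact (congrArg Sigma.fst hj').symm
    · rintro rfl
      exact ⟨j, rfl⟩
  rw [← hfib, ← Finset.card_erase_of_mem ((hmem v).2 rfl), ← Finset.card_union_of_disjoint]
  · congr 1
    ext w
    have hw0 := mem_untouchedParts.1 h
    by_cases hw : w = v
    · simp [openVertices, untouchedParts_update, hw, h]
    · by_cases hw1 : w.1 = v.1
      · obtain ⟨i, j⟩ := w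
        simp only at hw1
        subst hw1
        simp only [openVertices, untouchedParts_update, Finset.mem_union, Finset.mem_erase, hmem,
          Finset.mem_filter, Finset.mem_univ, true_and, Function.update_of_ne hw]
        simp [hw0, hw]
      · simp only [openVertices, untouchedParts_update, Finset.mem_union, Finset.mem_erase, hmem,
          Finset.mem_filter, Finset.mem_univ, true_and, Function.update_of_ne hw]
        simp [hw1]
  · rw [Finset.disjoint_left]
    intro w hw hw'
    rw [Finset.mem_erase, hmem] at hw'
    simp only [openVertices, Finset.mem_filter] at hw
    exact hw.2.2 (hw'.2 ▸ h)

theorem card_colored_update (hv : f v = none) :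
    (Finset.univ.filter fun w => (Function.update f v (some c) w).isSome = true).card =
      (Finset.univ.filter fun w => (f w).isSome = true).card + 1 := by
  rw [← Finset.card_insert_of_notMem (a := v) (by simp [hv])]
  congr 1
  ext w
  by_cases hw : w = v
  · simp [hw]
  · simp [hw]

/-- Alice's winning criterion evaluated at a position in which Alice is to move. -/
def AliceSafeAt (f : (Σ i : Fin k, Fin (r i)) → Option (Fin m)) : Prop :=
  AliceSafe (untouchedCount f 4) (untouchedCount f 3) (untouchedCount f 1)
    (openVertices f).card (freshColors f).card

/-- Alice's winning criterion evaluated at a position in which Bob is to move. -/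
def BobSafeAt (f : (Σ i : Fin k, Fin (r i)) → Option (Fin m)) : Prop :=
  BobSafe (untouchedCount f 4) (untouchedCount f 3) (untouchedCount f 1)
    (openVertices f).card (freshColors f).card

theorem untouchedCount_sum_pos (hr : ∀ i, r i = 4 ∨ r i = 3 ∨ r i = 1)
    (hv : v.1 ∈ untouchedParts f) :
    0 < untouchedCount f 4 + untouchedCount f 3 + untouchedCount f 1 := by
  have := untouchedCount_pos hv
  rcases hr v.1 with h | h | h <;> rw [h] at this <;> omega

theorem BobSafeAt.update (hr : ∀ i, r i = 4 ∨ r i = 3 ∨ r i = 1) (h : BobSafeAt f)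
    (hv : f v = none) (hc : legalColor (K k r) f v c) :
    AliceSafeAt (Function.update f v (some c)) := by
  unfold AliceSafeAt
  unfold BobSafeAt at h
  rw [freshColors_update hv]
  by_cases hu : v.1 ∈ untouchedParts f
  · have hpos := untouchedCount_pos hu
    have hdec := untouchedCount_update_of_mem (c := c) hu
    have hne := fun s => untouchedCount_update_of_ne (f := f) (v := v) (c := c) (s := s)
    rw [card_openVertices_update_of_mem hu,
      Finset.card_erase_of_mem (mem_freshColors_of_legalColor hu hc)]
    rcases hr v.1 with hs | hs | hs <;> rw [hs] at hpos hdec ⊢ <;> rw [hs] at hne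
    · rw [hdec, hne 3 (by norm_num), hne 1 (by norm_num)]
      exact h.four hpos
    · rw [hdec, hne 4 (by norm_num), hne 1 (by norm_num)]
      exact h.three hpos
    · rw [hdec, hne 4 (by norm_num), hne 3 (by norm_num)]
      exact h.one hpos
  · have ht : 0 < (openVertices f).card :=
      Finset.card_pos.2 ⟨v, by simp [openVertices, hv, hu]⟩
    simp only [untouchedCount_update_of_notMem hu, card_openVertices_update_of_notMem hv hu]
    by_cases hcf : c ∈ freshColors f
    · rw [Finset.card_erase_of_mem hcf]
      exact h.waste ht
    · rw [Finset.erase_eq_of_notMem hcf]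
      exact h.reuse ht

theorem exists_update_of_untouchedCount_pos {s : ℕ} (hs : 0 < s)
    (hpos : 0 < untouchedCount f s) (hF : 0 < (freshColors f).card) :
    ∃ v c, f v = none ∧ legalColor (K k r) f v c ∧ r v.1 = s ∧ v.1 ∈ untouchedParts f ∧
      c ∈ freshColors f := by
  obtain ⟨i, hi⟩ := Finset.card_pos.1 hpos
  obtain ⟨c, hc⟩ := Finset.card_pos.1 hF
  rw [Finset.mem_filter] at hi
  have hi' := mem_untouchedParts.1 hi.1
  exact ⟨⟨i, ⟨0, hi.2 ▸ hs⟩⟩, c, hi' _, legalColor_of_mem_freshColors hc, hi.2, hi.1, hc⟩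

theorem AliceSafeAt.exists_update (hr : ∀ i, r i = 4 ∨ r i = 3 ∨ r i = 1)
    (hf : IsProperPosition f) (h : AliceSafeAt f) (hv : f v = none) :
    ∃ v c, f v = none ∧ legalColor (K k r) f v c ∧ BobSafeAt (Function.update f v (some c)) := by
  have hreuse : ∀ w ∈ openVertices f, ∃ c, f w = none ∧ legalColor (K k r) f w c ∧
      (BobSafe (untouchedCount f 4) (untouchedCount f 3) (untouchedCount f 1)
        ((openVertices f).card - 1) (freshColors f).card →
      BobSafeAt (Function.update f w (some c))) := by
    intro w hw
    simp only [openVertices, Finset.mem_filter] at hw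
    obtain ⟨c, hc, hl⟩ := hf.exists_legalColor hw.2.2
    refine ⟨c, hw.2.1, hl, fun hB => ?_⟩
    unfold BobSafeAt
    rwa [freshColors_update hw.2.1, Finset.erase_eq_of_notMem hc,
      card_openVertices_update_of_notMem hw.2.1 hw.2.2, untouchedCount_update_of_notMem hw.2.2,
      untouchedCount_update_of_notMem hw.2.2, untouchedCount_update_of_notMem hw.2.2]
  rcases h with h | ⟨ht, hB⟩ | ⟨hF, ⟨ha, hB⟩ | ⟨hb, hB⟩ | ⟨hc, hB⟩⟩
  · have hu : v.1 ∉ untouchedParts f := fun hu => by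
      have := untouchedCount_sum_pos hr hu
      omega
    obtain ⟨c, h1, h2, h3⟩ := hreuse v (by simp [openVertices, hv, hu])
    exact ⟨v, c, h1, h2, h3 (Or.inl h)⟩
  · obtain ⟨w, hw⟩ := Finset.card_pos.1 ht
    obtain ⟨c, h1, h2, h3⟩ := hreuse w hw
    exact ⟨w, c, h1, h2, h3 hB⟩
  · obtain ⟨w, c, h1, h2, h3, h4, h5⟩ :=
      exists_update_of_untouchedCount_pos (by norm_num) ha hF
    refine ⟨w, c, h1, h2, ?_⟩
    have hdec := untouchedCount_update_of_mem (c := c) h4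
    unfold BobSafeAt
    rw [freshColors_update h1, Finset.card_erase_of_mem h5, card_openVertices_update_of_mem h4]
    rw [h3] at hdec ⊢
    rwa [hdec, untouchedCount_update_of_ne (s := 3) (by omega),
      untouchedCount_update_of_ne (s := 1) (by omega)]
  · obtain ⟨w, c, h1, h2, h3, h4, h5⟩ :=
      exists_update_of_untouchedCount_pos (by norm_num) hb hF
    refine ⟨w, c, h1, h2, ?_⟩
    have hdec := untouchedCount_update_of_mem (c := c) h4
    unfold BobSafeAt
    rw [freshColors_update h1, Finset.card_erase_of_mem h5, card_openVertices_update_of_mem h4]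
    rw [h3] at hdec ⊢
    rwa [hdec, untouchedCount_update_of_ne (s := 4) (by omega),
      untouchedCount_update_of_ne (s := 1) (by omega)]
  · obtain ⟨w, c, h1, h2, h3, h4, h5⟩ :=
      exists_update_of_untouchedCount_pos (by norm_num) hc hF
    refine ⟨w, c, h1, h2, ?_⟩
    have hdec := untouchedCount_update_of_mem (c := c) h4
    unfold BobSafeAt
    rw [freshColors_update h1, Finset.card_erase_of_mem h5, card_openVertices_update_of_mem h4]
    rw [h3] at hdec ⊢
    rwa [hdec, untouchedCount_update_of_ne (s := 4) (by omega),
      untouchedCount_update_of_ne (s := 3) (by omega)]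

theorem not_isStuck (hr : ∀ i, r i = 4 ∨ r i = 3 ∨ r i = 1) (hf : IsProperPosition f)
    (h : AliceSafeAt f ∨ BobSafeAt f) : ¬ isStuck (K k r) f := by
  rintro ⟨v, hv, hstuck⟩
  by_cases hu : v.1 ∈ untouchedParts f
  · have hn := untouchedCount_sum_pos hr hu
    have hF : 0 < (freshColors f).card := h.elim (fun h => h.pos hn) (fun h => h.pos hn)
    obtain ⟨c, hc⟩ := Finset.card_pos.1 hF
    exact hstuck c (legalColor_of_mem_freshColors hc)
  · obtain ⟨c, -, hc⟩ := hf.exists_legalColor hu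
    exact hstuck c hc

theorem aliceWinsFrom_of_safe (hr : ∀ i, r i = 4 ∨ r i = 3 ∨ r i = 1) (n : ℕ) :
    ∀ f : (Σ i : Fin k, Fin (r i)) → Option (Fin m), IsProperPosition f →
      (Finset.univ.filter fun v => (f v).isSome = true).card + n =
        Fintype.card (Σ i : Fin k, Fin (r i)) →
      (aliceTurn f → AliceSafeAt f) → (¬ aliceTurn f → BobSafeAt f) →
      aliceWinsFrom (K k r) n f := by
  induction n with
  | zero =>
    intro f _ hcard _ _ v
    have := (Finset.card_eq_iff_eq_univ _).1 hcard
    simpa using (Finset.ext_iff.1 this v).2 (Finset.mem_univ v)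
  | succ n ih =>
    intro f hf hcard hA hB
    have hturn : ∀ v c, f v = none →
        (aliceTurn (Function.update f v (some c)) ↔ ¬ aliceTurn f) := by
      intro v c hv
      unfold aliceTurn
      rw [card_colored_update hv, Nat.even_add_one]
    by_cases hturnf : aliceTurn f
    · refine Or.inr ⟨not_isStuck hr hf (Or.inl (hA hturnf)), Or.inl ⟨hturnf, ?_⟩⟩
      obtain ⟨u, hu⟩ : ∃ u, f u = none := by
        by_contra! hne
        have hfull : (Finset.univ.filter fun v => (f v).isSome = true) = Finset.univ :=
          Finset.filter_true_of_mem fun v _ => Option.isSome_iff_ne_none.2 (hne v)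
        rw [hfull, Finset.card_univ] at hcard
        omega
      obtain ⟨v, c, hv, hc, hs⟩ := (hA hturnf).exists_update hr hf hu
      refine ⟨_, ⟨v, c, hv, hc, rfl⟩, ih _ (hf.update hc) ?_ ?_ fun _ => hs⟩
      · rw [card_colored_update hv]
        omega
      · exact fun h => absurd hturnf ((hturn v c hv).1 h)
    · refine Or.inr ⟨not_isStuck hr hf (Or.inr (hB hturnf)), Or.inr ⟨hturnf, ?_⟩⟩
      rintro _ ⟨v, c, hv, hc, rfl⟩
      refine ih _ (hf.update hc) ?_ (fun _ => (hB hturnf).update hr hv hc) ?_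
      · rw [card_colored_update hv]
        omega
      · exact fun h => absurd ((hturn v c hv).2 hturnf) h

theorem aliceWins_of_aliceSafe (hr : ∀ i, r i = 4 ∨ r i = 3 ∨ r i = 1)
    (h : AliceSafe (Finset.univ.filter fun i => r i = 4).card
      (Finset.univ.filter fun i => r i = 3).card (Finset.univ.filter fun i => r i = 1).card 0 m) :
    aliceWins (K k r) m := by
  refine aliceWinsFrom_of_safe hr _ _ (fun _ _ _ h => by simp at h) (by simp) (fun _ => ?_) ?_
  · simpa [AliceSafeAt, untouchedCount, untouchedParts, openVertices, freshColors] using h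
  · intro h
    simp [aliceTurn] at h

end Position

theorem game_chromatic_K433s11 (k : ℕ) (hk : 6 ≤ k) :
    gameChromaticNumber
      (K k (fun i => if (i : ℕ) = 0 then 4 else if (i : ℕ) < k - 2 then 3 else 1))
      ≤ 2 * k - 4 := by
  refine Nat.sInf_le (aliceWins_of_aliceSafe (fun i => by split_ifs <;> simp) ?_)
  obtain ⟨b, rfl⟩ : ∃ b, k = b + 3 := ⟨k - 3, by omega⟩
  have h4 : (Finset.univ.filter fun i : Fin (b + 3) =>
      (if (i : ℕ) = 0 then 4 else if (i : ℕ) < b + 3 - 2 then 3 else 1) = 4).card = 1 := by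
    rw [Finset.card_eq_one]
    refine ⟨0, ?_⟩
    ext i
    simp only [Finset.mem_filter, Finset.mem_univ, true_and, Finset.mem_singleton, Fin.ext_iff,
      Fin.val_zero]
    split_ifs <;> simp_all
  have h1 : (Finset.univ.filter fun i : Fin (b + 3) =>
      (if (i : ℕ) = 0 then 4 else if (i : ℕ) < b + 3 - 2 then 3 else 1) = 1).card = 2 := by
    rw [Finset.card_eq_two]
    refine ⟨⟨b + 1, by omega⟩, ⟨b + 2, by omega⟩, by simp, ?_⟩
    ext i
    simp only [Finset.mem_filter, Finset.mem_univ, true_and, Finset.mem_singleton,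
      Finset.mem_insert, Fin.ext_iff]
    split_ifs <;> simp <;> omega
  have h3 : (Finset.univ.filter fun i : Fin (b + 3) =>
      (if (i : ℕ) = 0 then 4 else if (i : ℕ) < b + 3 - 2 then 3 else 1) = 3).card = b := by
    have himage : (Finset.univ.filter fun i : Fin (b + 3) =>
        (if (i : ℕ) = 0 then 4 else if (i : ℕ) < b + 3 - 2 then 3 else 1) = 3) =
        Finset.Icc ⟨1, by omega⟩ ⟨b, by omega⟩ := by
      ext i
      simp only [Finset.mem_filter, Finset.mem_univ, true_and, Finset.mem_Icc, Fin.le_def]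
      split_ifs <;> simp <;> omega
    rw [himage, Fin.card_Icc]
    simp
  rw [h4, h3, h1, show 2 * (b + 3) - 4 = 2 * b + 2 by omega]
  exact aliceSafe_initial (by omega)
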